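/- arXiv:2502.00705 — 2 statements merged into one kernel-verified Lean document; each statement's English description precedes it below -/
import Mathlib

section
/- Local loss reduction under RSC and smoothness: Let 𝓛:ℝ^p→ℝ be continuously differentiable, let 𝒩_t⊆ℝ^p be non-empty, let θ_t∈ℝ^p, and let 0<α_t≤β. Let θ_{t+1}=θ_t−η_t∇𝓛(θ_t) with η_t=ω_t/β for some ω_t∈(0,2). Assume 𝓛 satisfies α_t-RSC with respect to (𝒩_t,θ_t) and that 𝓛 is β-smooth on a set containing both θ_t and θ_{t+1}. Then 𝓛(θ_{t+1}) − inf_{θ∈𝒩_t}𝓛(θ) ≤ (1 − (α_t ω_t/β)(2−ω_t)) · (𝓛(θ_t) − inf_{θ∈𝒩_t}𝓛(θ)). -/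
open scoped RealInnerProductSpace

/-- Lower bound, uniform in `x`, for the quadratic `⟪x, g⟫ + α / 2 * ‖x‖ ^ 2`. -/
theorem neg_norm_sq_div_le_inner_add_norm_sq {E : Type*} [NormedAddCommGroup E]
    [InnerProductSpace ℝ E] {α : ℝ} (hα : 0 < α) (x g : E) :
    -(‖g‖ ^ 2 / (2 * α)) ≤ ⟪x, g⟫ + α / 2 * ‖x‖ ^ 2 := by
  have h : 0 ≤ ‖g + α • x‖ ^ 2 := by positivity
  rw [norm_add_sq_real, real_inner_smul_right, norm_smul, mul_pow, Real.norm_eq_abs, sq_abs,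
    real_inner_comm] at h
  have key : ⟪x, g⟫ + α / 2 * ‖x‖ ^ 2 + ‖g‖ ^ 2 / (2 * α) =
      (‖g‖ ^ 2 + 2 * (α * ⟪x, g⟫) + α ^ 2 * ‖x‖ ^ 2) / (2 * α) := by
    field_simp
    ring
  have : 0 ≤ (‖g‖ ^ 2 + 2 * (α * ⟪x, g⟫) + α ^ 2 * ‖x‖ ^ 2) / (2 * α) := by positivity
  linarith

/-- **Local loss reduction under RSC and smoothness.**
If `𝓛` satisfies `α_t`-RSC w.r.t. `(𝒩_t, θ_t)` with `0 < α_t ≤ β`, is `β`-smooth on a set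
containing both `θ_t` and the gradient-descent update `θ_{t+1} = θ_t − (ω_t/β) ∇𝓛(θ_t)`
with `ω_t ∈ (0,2)`, then
`𝓛(θ_{t+1}) − inf_{𝒩_t} 𝓛 ≤ (1 − (α_t ω_t/β)(2 − ω_t)) (𝓛(θ_t) − inf_{𝒩_t} 𝓛)`. -/
theorem local_loss_reduction {p : ℕ}
    (𝓛 : EuclideanSpace ℝ (Fin p) → ℝ) (h𝓛 : ContDiff ℝ 1 𝓛)
    (θt : EuclideanSpace ℝ (Fin p)) (𝒩t : Set (EuclideanSpace ℝ (Fin p)))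
    (h𝒩t : 𝒩t.Nonempty) (αt β ωt : ℝ) (hαt : 0 < αt) (hαβ : αt ≤ β)
    (hωt : ωt ∈ Set.Ioo (0 : ℝ) 2)
    (θnext : EuclideanSpace ℝ (Fin p))
    (hθnext : θnext = θt - (ωt / β) • gradient 𝓛 θt)
    (hRSC : ∀ θ' ∈ 𝒩t,
      𝓛 θt + ⟪θ' - θt, gradient 𝓛 θt⟫ + αt / 2 * ‖θ' - θt‖ ^ 2 ≤ 𝓛 θ')
    (B : Set (EuclideanSpace ℝ (Fin p))) (hθtB : θt ∈ B) (hθnextB : θnext ∈ B)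
    (hsmooth : ∀ θ ∈ B, ∀ θ' ∈ B,
      𝓛 θ' ≤ 𝓛 θ + ⟪θ' - θ, gradient 𝓛 θ⟫ + β / 2 * ‖θ' - θ‖ ^ 2) :
    𝓛 θnext - sInf (𝓛 '' 𝒩t) ≤
      (1 - αt * ωt / β * (2 - ωt)) * (𝓛 θt - sInf (𝓛 '' 𝒩t)) := by
  obtain ⟨hω0, hω2⟩ := hωt
  have hβ : 0 < β := hαt.trans_le hαβ
  set g := gradient 𝓛 θt
  have hinf : 𝓛 θt - ‖g‖ ^ 2 / (2 * αt) ≤ sInf (𝓛 '' 𝒩t) := by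
    refine le_csInf (h𝒩t.image 𝓛) ?_
    rintro _ ⟨θ', hθ', rfl⟩
    linarith [hRSC θ' hθ', neg_norm_sq_div_le_inner_add_norm_sq hαt (θ' - θt) g]
  have hgap : αt * (𝓛 θt - sInf (𝓛 '' 𝒩t)) ≤ ‖g‖ ^ 2 / 2 := by
    calc αt * (𝓛 θt - sInf (𝓛 '' 𝒩t)) ≤ αt * (‖g‖ ^ 2 / (2 * αt)) := by
          gcongr
          linarith
      _ = ‖g‖ ^ 2 / 2 := by field_simp
  have hdescent : 𝓛 θnext ≤ 𝓛 θt - ωt / β * (2 - ωt) * (‖g‖ ^ 2 / 2) := by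
    have h := hsmooth θt hθtB θnext hθnextB
    have hstep : θnext - θt = -((ωt / β) • g) := by rw [hθnext]; abel
    rw [hstep, inner_neg_left, real_inner_smul_left, real_inner_self_eq_norm_sq, norm_neg,
      norm_smul, mul_pow, Real.norm_eq_abs, sq_abs] at h
    refine h.trans_eq ?_
    field_simp
    ring
  have hrate : 0 ≤ ωt / β * (2 - ωt) := mul_nonneg (by positivity) (by linarith)
  have hmul := mul_le_mul_of_nonneg_left hgap hrate
  calc 𝓛 θnext - sInf (𝓛 '' 𝒩t)
      ≤ 𝓛 θt - sInf (𝓛 '' 𝒩t) -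
          ωt / β * (2 - ωt) * (αt * (𝓛 θt - sInf (𝓛 '' 𝒩t))) := by linarith
    _ = _ := by ring
end

section
/- Global loss reduction (main optimization theorem): Let 𝓛:ℝ^p→ℝ be continuously differentiable and bounded below on a set ℬ(θ₀)⊆ℝ^p. Let θ_t∈ℬ(θ₀) and θ_{t+1}=θ_t−η_t∇𝓛(θ_t)∈ℬ(θ₀) with η_t=ω_t/β, ω_t∈(0,2). Assume: (1) 𝓛 is β-smooth on ℬ(θ₀); (2) there is a non-empty set 𝒩_t⊆ℬ(θ₀) such that EITHER (b.1) θ_{t+1}∈𝒩_t and (θ_t∉𝒩_t or 𝓛(θ_t)≠inf_{θ∈𝒩_t}𝓛(θ)), OR (b.2) there exists θ'∈𝒩_t with 𝓛(θ')<𝓛(θ_t); (3) 𝓛 satisfies α_t-RSC with respect to (𝒩_t,θ_t) with 0<α_t≤β; and (4) 𝓛(θ_t)≠inf_{θ∈ℬ(θ₀)}𝓛(θ). Then γ_t := (inf_{θ∈𝒩_t}𝓛(θ) − inf_{θ∈ℬ(θ₀)}𝓛(θ))/(𝓛(θ_t) − inf_{θ∈ℬ(θ₀)}𝓛(θ)) satisfies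 0≤γ_t<1, and 𝓛(θ_{t+1}) − inf_{θ∈ℬ(θ₀)}𝓛(θ) ≤ (1 − (α_t ω_t(1−γ_t)/β)(2−ω_t)) · (𝓛(θ_t) − inf_{θ∈ℬ(θ₀)}𝓛(θ)). -/
open scoped RealInnerProductSpace

/-- One gradient step with step size `ω / β` decreases a function satisfying the quadratic upper
bound by at least `ω (2 - ω) / (2 β) * ‖g‖ ^ 2`. -/
theorem le_sub_of_quadratic_upper_bound {E : Type*} [NormedAddCommGroup E]
    [InnerProductSpace ℝ E] {f : E → ℝ} {x g : E} {β ω : ℝ} (hβ : β ≠ 0)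
    (h : f (x - (ω / β) • g) ≤ f x + ⟪x - (ω / β) • g - x, g⟫
      + β / 2 * ‖x - (ω / β) • g - x‖ ^ 2) :
    f (x - (ω / β) • g) ≤ f x - ω * (2 - ω) / (2 * β) * ‖g‖ ^ 2 := by
  have hd : x - (ω / β) • g - x = -((ω / β) • g) := by abel
  rw [hd, norm_neg, norm_smul, mul_pow, Real.norm_eq_abs, sq_abs, inner_neg_left,
    real_inner_smul_left, real_inner_self_eq_norm_sq] at h
  refine h.trans_eq ?_
  field_simp
  ring

/-- A linear functional plus a positive multiple of the squared norm is bounded below. -/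
theorem neg_sq_norm_div_le_inner_add {E : Type*} [NormedAddCommGroup E]
    [InnerProductSpace ℝ E] {α : ℝ} (hα : 0 < α) (d g : E) :
    -(‖g‖ ^ 2 / (2 * α)) ≤ ⟪d, g⟫ + α / 2 * ‖d‖ ^ 2 := by
  have hsq : 0 ≤ (α * ‖d‖ - ‖g‖) ^ 2 / (2 * α) := by positivity
  have heq : (α * ‖d‖ - ‖g‖) ^ 2 / (2 * α)
      = α / 2 * ‖d‖ ^ 2 - ‖d‖ * ‖g‖ + ‖g‖ ^ 2 / (2 * α) := by
    field_simp
    ring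
  have hcs := (abs_le.mp (abs_real_inner_le_norm d g)).1
  linarith

/-- **Global loss reduction (main optimization theorem).**
Under `β`-smoothness on `ℬ(θ₀)`, the RSC condition on a nonempty `𝒩_t ⊆ ℬ(θ₀)` (together
with membership condition (b.1) or (b.2)), `0 < α_t ≤ β`, and `𝓛(θ_t) ≠ inf_{ℬ(θ₀)} 𝓛`,
the gradient-descent update `θ_{t+1} = θ_t − (ω_t/β)∇𝓛(θ_t)` with `ω_t ∈ (0,2)` satisfies
`0 ≤ γ_t < 1` and
`𝓛(θ_{t+1}) − inf_{ℬ(θ₀)}𝓛 ≤ (1 − (α_t ω_t (1−γ_t)/β)(2−ω_t)) (𝓛(θ_t) − inf_{ℬ(θ₀)}𝓛)`,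
where `γ_t = (inf_{𝒩_t}𝓛 − inf_{ℬ(θ₀)}𝓛)/(𝓛(θ_t) − inf_{ℬ(θ₀)}𝓛)`. -/
theorem global_loss_reduction {p : ℕ}
    (𝓛 : EuclideanSpace ℝ (Fin p) → ℝ) (h𝓛 : ContDiff ℝ 1 𝓛)
    (ℬ : Set (EuclideanSpace ℝ (Fin p))) (hBdd : BddBelow (𝓛 '' ℬ))
    (θt : EuclideanSpace ℝ (Fin p)) (hθtB : θt ∈ ℬ)
    (αt β ωt : ℝ) (hαt : 0 < αt) (hαβ : αt ≤ β) (hωt : ωt ∈ Set.Ioo (0 : ℝ) 2)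
    (θnext : EuclideanSpace ℝ (Fin p))
    (hθnext : θnext = θt - (ωt / β) • gradient 𝓛 θt) (hθnextB : θnext ∈ ℬ)
    (hsmooth : ∀ θ ∈ ℬ, ∀ θ' ∈ ℬ,
      𝓛 θ' ≤ 𝓛 θ + ⟪θ' - θ, gradient 𝓛 θ⟫ + β / 2 * ‖θ' - θ‖ ^ 2)
    (𝒩t : Set (EuclideanSpace ℝ (Fin p))) (h𝒩t : 𝒩t.Nonempty) (h𝒩tB : 𝒩t ⊆ ℬ)
    (hb : (θnext ∈ 𝒩t ∧ (θt ∉ 𝒩t ∨ 𝓛 θt ≠ sInf (𝓛 '' 𝒩t))) ∨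
          (∃ θ' ∈ 𝒩t, 𝓛 θ' < 𝓛 θt))
    (hRSC : ∀ θ' ∈ 𝒩t,
      𝓛 θt + ⟪θ' - θt, gradient 𝓛 θt⟫ + αt / 2 * ‖θ' - θt‖ ^ 2 ≤ 𝓛 θ')
    (hne : 𝓛 θt ≠ sInf (𝓛 '' ℬ)) :
    0 ≤ (sInf (𝓛 '' 𝒩t) - sInf (𝓛 '' ℬ)) / (𝓛 θt - sInf (𝓛 '' ℬ)) ∧
    (sInf (𝓛 '' 𝒩t) - sInf (𝓛 '' ℬ)) / (𝓛 θt - sInf (𝓛 '' ℬ)) < 1 ∧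
    𝓛 θnext - sInf (𝓛 '' ℬ) ≤
      (1 - αt * ωt *
          (1 - (sInf (𝓛 '' 𝒩t) - sInf (𝓛 '' ℬ)) / (𝓛 θt - sInf (𝓛 '' ℬ))) / β *
          (2 - ωt)) *
        (𝓛 θt - sInf (𝓛 '' ℬ)) := by
  obtain ⟨hω0, hω2⟩ := hωt
  have hβ : 0 < β := hαt.trans_le hαβ
  have hBddN : BddBelow (𝓛 '' 𝒩t) := hBdd.mono (Set.image_mono h𝒩tB)
  have hstep : 𝓛 θnext ≤
      𝓛 θt - ωt * (2 - ωt) / (2 * β) * ‖gradient 𝓛 θt‖ ^ 2 := by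
    have h := hsmooth θt hθtB θnext hθnextB
    rw [hθnext] at h ⊢
    exact le_sub_of_quadratic_upper_bound hβ.ne' h
  have hcoef : 0 < ωt * (2 - ωt) / (2 * β) :=
    div_pos (mul_pos hω0 (by linarith)) (by linarith)
  have hinf : sInf (𝓛 '' ℬ) ≤ sInf (𝓛 '' 𝒩t) :=
    csInf_le_csInf hBdd (h𝒩t.image 𝓛) (Set.image_mono h𝒩tB)
  have hgap : 0 < 𝓛 θt - sInf (𝓛 '' ℬ) :=
    sub_pos.mpr ((csInf_le hBdd (Set.mem_image_of_mem 𝓛 hθtB)).lt_of_ne' hne)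
  have hlt : sInf (𝓛 '' 𝒩t) < 𝓛 θt := by
    rcases hb with ⟨hmem, hor⟩ | ⟨θ', hθ', hθ'lt⟩
    · have hle := csInf_le hBddN (Set.mem_image_of_mem 𝓛 hmem)
      by_cases hg : gradient 𝓛 θt = 0
      · have heq : θnext = θt := by simp [hθnext, hg]
        rw [heq] at hmem hle
        exact hle.lt_of_ne' (hor.resolve_left (not_not_intro hmem))
      · have hpos : 0 < ωt * (2 - ωt) / (2 * β) * ‖gradient 𝓛 θt‖ ^ 2 :=
          mul_pos hcoef (pow_pos (norm_pos_iff.mpr hg) 2)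
        linarith
    · exact (csInf_le hBddN (Set.mem_image_of_mem 𝓛 hθ')).trans_lt hθ'lt
  have hlower : 𝓛 θt - ‖gradient 𝓛 θt‖ ^ 2 / (2 * αt) ≤ sInf (𝓛 '' 𝒩t) := by
    refine le_csInf (h𝒩t.image 𝓛) ?_
    rintro _ ⟨θ', hθ', rfl⟩
    linarith [hRSC θ' hθ', neg_sq_norm_div_le_inner_add hαt (θ' - θt) (gradient 𝓛 θt)]
  have hgrad : 2 * αt * (𝓛 θt - sInf (𝓛 '' 𝒩t)) ≤ ‖gradient 𝓛 θt‖ ^ 2 := by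
    rw [← le_div_iff₀' (by positivity)]
    linarith
  refine ⟨div_nonneg (sub_nonneg.mpr hinf) hgap.le, ?_, ?_⟩
  · rw [div_lt_one hgap]
    linarith
  · have hmul := mul_le_mul_of_nonneg_left hgrad hcoef.le
    have hrhs : (1 - αt * ωt *
          (1 - (sInf (𝓛 '' 𝒩t) - sInf (𝓛 '' ℬ)) / (𝓛 θt - sInf (𝓛 '' ℬ))) / β *
          (2 - ωt)) * (𝓛 θt - sInf (𝓛 '' ℬ))
        = 𝓛 θt - sInf (𝓛 '' ℬ)
          - ωt * (2 - ωt) / (2 * β) * (2 * αt * (𝓛 θt - sInf (𝓛 '' 𝒩t))) := by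
      have hgap' := hgap.ne'
      field_simp
      ring
    rw [hrhs]
    linarith
end
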